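/- arXiv:1107.1878 — 3 statements merged into one kernel-verified Lean document; each statement's English description precedes it below -/
import Mathlib

section
/- Each of the trominoes P₃,₁ = {(0,0),(0,1),(0,2)} and P₃,₂ = {(0,0),(0,1),(1,1)} has threshold sequence (1,7,∞): each is a (1,1)-winner, a (1,2)-loser, a (2,7)-winner, a (2,8)-loser, and an (n,b)-winner for every n ≥ 3 and every b ∈ ℕ. -/
/-- Cells of the square board. -/
abbrev Cell : Type := ℤ × ℤ

/-- Two cells are adjacent if they differ by `(±1,0)` or `(0,±1)`. -/
def Adjacent (p q : Cell) : Prop :=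
  (p.1 - q.1).natAbs + (p.2 - q.2).natAbs = 1

/-- A polyomino is a finite nonempty set of cells that is connected under adjacency. -/
def IsPolyomino (A : Finset Cell) : Prop :=
  A.Nonempty ∧ ∀ p ∈ A, ∀ q ∈ A,
    Relation.ReflTransGen (fun u v => u ∈ A ∧ v ∈ A ∧ Adjacent u v) p q

/-- A symmetry of the square lattice: a translation composed with a rotation by a
multiple of 90 degrees and possibly a reflection. -/
def IsSquareSymmetry (f : Cell → Cell) : Prop :=
  ∃ (e₁ e₂ : ℤ) (s : Bool) (t : Cell),
    (e₁ = 1 ∨ e₁ = -1) ∧ (e₂ = 1 ∨ e₂ = -1) ∧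
    ∀ p : Cell, f p =
      if s then (e₁ * p.2 + t.1, e₂ * p.1 + t.2)
      else (e₁ * p.1 + t.1, e₂ * p.2 + t.2)

/-- `P` is a placement of the polyomino `A`: the image of `A` under a symmetry
of the square lattice. -/
def IsPlacement (A : Finset Cell) (P : Set Cell) : Prop :=
  ∃ f : Cell → Cell, IsSquareSymmetry f ∧ P = f '' (↑A : Set Cell)

/-- The maker's move on his `n`-th turn (`0`-indexed), given his strategy `σ`
(a function of the list of the breaker's previous moves, which together with `σ`
determines the whole history) and the breaker's sequence of moves `β`. -/
def makerMove (σ : List (Finset Cell) → Finset Cell) (β : ℕ → Finset Cell) (n : ℕ) :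
    Finset Cell :=
  σ ((List.range n).map β)

/-- The set of cells marked by the maker after his first `n` turns. -/
def makerMarks (σ : List (Finset Cell) → Finset Cell) (β : ℕ → Finset Cell) :
    ℕ → Finset Cell
  | 0 => ∅
  | n + 1 => makerMarks σ β n ∪ makerMove σ β n

/-- The set of cells marked by the breaker after her first `n` turns. -/
def breakerMarks (β : ℕ → Finset Cell) : ℕ → Finset Cell
  | 0 => ∅
  | n + 1 => breakerMarks β n ∪ β n

/-- The maker plays legally: on every turn he marks exactly `a` previously unmarked cells. -/
def MakerLegal (a : ℕ) (σ : List (Finset Cell) → Finset Cell) (β : ℕ → Finset Cell) : Prop :=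
  ∀ n, (makerMove σ β n).card = a ∧
    Disjoint (makerMove σ β n) (makerMarks σ β n ∪ breakerMarks β n)

/-- The breaker plays legally: on every turn she marks exactly `b` previously unmarked
cells (on turn `n` she moves after the maker, so she must avoid `makerMarks σ β (n+1)`). -/
def BreakerLegal (b : ℕ) (σ : List (Finset Cell) → Finset Cell) (β : ℕ → Finset Cell) : Prop :=
  ∀ n, (β n).card = b ∧ Disjoint (β n) (makerMarks σ β (n + 1) ∪ breakerMarks β n)

/-- `A` is an `(a,b)`-winner: the maker has a winning strategy in the weak `(a,b)`
achievement game with goal `A`, i.e. a strategy that always plays legally against any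
legal breaker play and eventually marks all cells of some placement of `A`. -/
def IsWinner (A : Finset Cell) (a b : ℕ) : Prop :=
  ∃ σ : List (Finset Cell) → Finset Cell, ∀ β : ℕ → Finset Cell,
    BreakerLegal b σ β →
      MakerLegal a σ β ∧
        ∃ n, ∃ P : Set Cell, IsPlacement A P ∧ P ⊆ ↑(makerMarks σ β n)

/-- The straight tromino `P₃,₁`. -/
def P31 : Finset Cell := {(0, 0), (0, 1), (0, 2)}

/-- The L-tromino `P₃,₂`. -/
def P32 : Finset Cell := {(0, 0), (0, 1), (1, 1)}

namespace Trom

/-- Fresh extension: any small set avoiding `X` extends to a set of size `b` avoiding `X`. -/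
theorem exists_fresh (F X : Finset Cell) (b : ℕ) (hd : Disjoint F X) (hF : F.card ≤ b) :
    ∃ E : Finset Cell, F ⊆ E ∧ E.card = b ∧ Disjoint E X := by
  obtain ⟨t, ht, hc⟩ := Infinite.exists_superset_card_eq (F ∪ X) (b + X.card)
    (by rw [Finset.card_union_of_disjoint hd]; omega)
  refine ⟨t \ X, ?_, ?_, Finset.sdiff_disjoint⟩
  · intro x hx
    exact Finset.mem_sdiff.2 ⟨ht (Finset.mem_union_left _ hx), Finset.disjoint_left.1 hd hx⟩
  · rw [Finset.card_sdiff_of_subset (Finset.subset_union_right.trans ht)]; omega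

theorem range_map_succ (β : ℕ → Finset Cell) (n : ℕ) :
    (List.range (n + 1)).map β = (List.range n).map β ++ [β n] := by
  simp [List.range_succ]

/-- Maker to move wins within `k` turns. -/
def W (A : Finset Cell) (a b : ℕ) : ℕ → Finset Cell → Finset Cell → Prop
  | 0, M, _ => ∃ P : Set Cell, IsPlacement A P ∧ P ⊆ ↑M
  | k + 1, M, B => ∃ D : Finset Cell, D.card = a ∧ Disjoint D (M ∪ B) ∧
      ∀ E : Finset Cell, E.card = b → Disjoint E (M ∪ D ∪ B) → W A a b k (M ∪ D) (B ∪ E)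

theorem W_move (A : Finset Cell) (a b k : ℕ) (M B : Finset Cell) :
    ∃ D : Finset Cell, D.card = a ∧ Disjoint D (M ∪ B) ∧
      ∀ j, k = j + 1 → W A a b k M B → ∀ E : Finset Cell, E.card = b →
        Disjoint E (M ∪ D ∪ B) → W A a b j (M ∪ D) (B ∪ E) := by
  by_cases h : ∃ j, k = j + 1 ∧ W A a b k M B
  · obtain ⟨j, rfl, D, h1, h2, h3⟩ := h
    refine ⟨D, h1, h2, ?_⟩
    intro i hi _
    obtain rfl : j = i := by omega
    exact h3
  · obtain ⟨D, -, h1, h2⟩ := exists_fresh ∅ (M ∪ B) a (Finset.disjoint_empty_left _) (by simp)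
    exact ⟨D, h1, h2, fun j hj hW => (h ⟨j, hj, hW⟩).elim⟩

theorem winner_of_W (A : Finset Cell) (a b K : ℕ) (hW : W A a b K ∅ ∅) : IsWinner A a b := by
  choose mv h1 h2 h3 using W_move A a b
  let step : ℕ × Finset Cell × Finset Cell → Finset Cell → ℕ × Finset Cell × Finset Cell :=
    fun s E => (s.1 - 1, s.2.1 ∪ mv s.1 s.2.1 s.2.2, s.2.2 ∪ E)
  let st : List (Finset Cell) → ℕ × Finset Cell × Finset Cell :=
    fun l => l.foldl step (K, ∅, ∅)
  let σ : List (Finset Cell) → Finset Cell :=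
    fun l => mv (st l).1 (st l).2.1 (st l).2.2
  refine ⟨σ, fun β hβ => ?_⟩
  have hst : ∀ n, st ((List.range n).map β) = (K - n, makerMarks σ β n, breakerMarks β n) := by
    intro n
    induction n with
    | zero => rfl
    | succ n ih =>
      have e : st ((List.range (n + 1)).map β) = step (st ((List.range n).map β)) (β n) := by
        rw [range_map_succ]
        simp only [st, List.foldl_append, List.foldl_cons, List.foldl_nil]
      have e2 : makerMove σ β n = mv (K - n) (makerMarks σ β n) (breakerMarks β n) := by
        simp only [makerMove, σ, ih]
      rw [e, ih]
      simp only [step, makerMarks, breakerMarks, e2]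
      rw [Nat.sub_sub]
  have hmv : ∀ n, makerMove σ β n = mv (K - n) (makerMarks σ β n) (breakerMarks β n) := by
    intro n
    simp only [makerMove, σ, hst]
  have hinv : ∀ n, n ≤ K → W A a b (K - n) (makerMarks σ β n) (breakerMarks β n) := by
    intro n
    induction n with
    | zero => intro _; exact hW
    | succ n ih =>
      intro hn
      have := h3 (K - n) (makerMarks σ β n) (breakerMarks β n) (K - (n + 1)) (by omega)
        (ih (by omega)) (β n) (hβ n).1 (by
          rw [← hmv]; exact (hβ n).2)
      rw [← hmv] at this
      exact this
  refine ⟨fun n => ?_, K, ?_⟩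
  · rw [hmv]
    exact ⟨h1 _ _ _, h2 _ _ _⟩
  · have := hinv K le_rfl
    rw [Nat.sub_self] at this
    exact this

theorem makerMarks_mem (σ : List (Finset Cell) → Finset Cell) (β : ℕ → Finset Cell) (n : ℕ)
    (x : Cell) : x ∈ makerMarks σ β n ↔ ∃ i < n, x ∈ makerMove σ β i := by
  induction n with
  | zero => simp [makerMarks]
  | succ n ih =>
    simp only [makerMarks, Finset.mem_union, ih]
    constructor
    · rintro (⟨i, hi, h⟩ | h)
      · exact ⟨i, by omega, h⟩
      · exact ⟨n, by omega, h⟩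
    · rintro ⟨i, hi, h⟩
      rcases Nat.lt_succ_iff_lt_or_eq.1 hi with h' | rfl
      · exact Or.inl ⟨i, h', h⟩
      · exact Or.inr h

theorem marks_mono (σ : List (Finset Cell) → Finset Cell) (β : ℕ → Finset Cell) {i j : ℕ}
    (h : i ≤ j) :
    makerMarks σ β i ∪ breakerMarks β i ⊆ makerMarks σ β j ∪ breakerMarks β j := by
  induction j, h using Nat.le_induction with
  | base => exact subset_rfl
  | succ j _ ih =>
    refine ih.trans ?_
    simp only [makerMarks, breakerMarks]
    exact Finset.union_subset_union Finset.subset_union_left Finset.subset_union_left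

theorem loser (A : Finset Cell) (a b c : ℕ) (N : Cell → Finset Cell) (hN : ∀ x, (N x).card ≤ c)
    (hsym : ∀ x y, y ∈ N x → x ∈ N y) (hb : a * c ≤ b)
    (hA : ∀ P : Set Cell, IsPlacement A P → ∀ t : Cell → ℕ,
      (∀ x ∈ P, ∀ y ∈ P, y ∈ N x → t x = t y) →
      ∃ S : Finset Cell, a < S.card ∧ ↑S ⊆ P ∧ ∀ x ∈ S, ∀ y ∈ S, t x = t y) :
    ¬ IsWinner A a b := by
  rintro ⟨σ, hσ⟩
  have hresp : ∀ M B D : Finset Cell, ∃ E : Finset Cell, E.card = b ∧ Disjoint E (M ∪ B) ∧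
      (D.card = a → ∀ x ∈ D, ∀ y ∈ N x, y ∈ M ∪ (B ∪ E)) := by
    intro M B D
    by_cases hD : D.card = a
    · obtain ⟨E, h1, h2, h3⟩ := exists_fresh (D.biUnion N \ (M ∪ B)) (M ∪ B) b
        Finset.sdiff_disjoint (by
          refine (Finset.card_le_card Finset.sdiff_subset).trans ?_
          refine (Finset.card_biUnion_le_card_mul D N c (fun x _ => hN x)).trans ?_
          rw [hD]; exact hb)
      refine ⟨E, h2, h3, fun _ x hx y hy => ?_⟩
      by_cases hy' : y ∈ M ∪ B
      · rcases Finset.mem_union.1 hy' with h | h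
        · exact Finset.mem_union_left _ h
        · exact Finset.mem_union_right _ (Finset.mem_union_left _ h)
      · refine Finset.mem_union_right _ (Finset.mem_union_right _ (h1 ?_))
        exact Finset.mem_sdiff.2 ⟨Finset.mem_biUnion.2 ⟨x, hx, hy⟩, hy'⟩
    · obtain ⟨E, -, h2, h3⟩ := exists_fresh ∅ (M ∪ B) b (Finset.disjoint_empty_left _) (by simp)
      exact ⟨E, h2, h3, fun h => (hD h).elim⟩
  choose resp r1 r2 r3 using hresp
  let out : List (Finset Cell) × Finset Cell × Finset Cell → Finset Cell :=
    fun s => resp (s.2.1 ∪ σ s.1) s.2.2 (σ s.1)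
  let step : List (Finset Cell) × Finset Cell × Finset Cell →
      List (Finset Cell) × Finset Cell × Finset Cell :=
    fun s => (s.1 ++ [out s], s.2.1 ∪ σ s.1, s.2.2 ∪ out s)
  let st : ℕ → List (Finset Cell) × Finset Cell × Finset Cell :=
    fun n => Nat.rec ([], ∅, ∅) (fun _ s => step s) n
  let β : ℕ → Finset Cell := fun n => out (st n)
  have hst : ∀ n, st n = ((List.range n).map β, makerMarks σ β n, breakerMarks β n) := by
    intro n
    induction n with
    | zero => rfl
    | succ n ih =>
      have e : st (n + 1) = ((st n).1 ++ [β n], (st n).2.1 ∪ σ (st n).1, (st n).2.2 ∪ β n) := rfl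
      rw [e, ih, range_map_succ]
      rfl
  have hβ : ∀ n, β n = resp (makerMarks σ β (n + 1)) (breakerMarks β n) (makerMove σ β n) := by
    intro n
    have e : β n = resp ((st n).2.1 ∪ σ (st n).1) (st n).2.2 (σ (st n).1) := rfl
    rw [e, hst]
    rfl
  have hleg : BreakerLegal b σ β := by
    intro n
    rw [hβ n]
    exact ⟨r1 _ _ _, r2 _ _ _⟩
  obtain ⟨hm, n, P, hP, hsub⟩ := hσ β hleg
  have key : ∀ i j x y, x ∈ makerMove σ β i → y ∈ makerMove σ β j → y ∈ N x → ¬ i < j := by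
    intro i j x y hx hy hxy hij
    have h := r3 (makerMarks σ β (i + 1)) (breakerMarks β i) (makerMove σ β i) (hm i).1 x hx y hxy
    rw [← hβ i] at h
    have h' := marks_mono σ β (Nat.succ_le_of_lt hij) h
    exact Finset.disjoint_left.1 (hm j).2 hy h'
  have ht : ∀ x : Cell, ∃ i, x ∈ P → x ∈ makerMove σ β i := by
    intro x
    by_cases hx : x ∈ P
    · obtain ⟨i, -, h⟩ := (makerMarks_mem σ β n x).1 (hsub hx)
      exact ⟨i, fun _ => h⟩
    · exact ⟨0, fun h => (hx h).elim⟩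
  choose t ht using ht
  obtain ⟨S, hS, hSP, hSt⟩ := hA P hP t (fun x hx y hy hxy => by
    have h1 := key _ _ x y (ht x hx) (ht y hy) hxy
    have h2 := key _ _ y x (ht y hy) (ht x hx) (hsym _ _ hxy)
    omega)
  have hne : S.Nonempty := Finset.card_pos.1 (by omega)
  obtain ⟨x, hx⟩ := hne
  have hsubS : S ⊆ makerMove σ β (t x) := by
    intro y hy
    rw [hSt x hx y hy]
    exact ht y (hSP hy)
  have := Finset.card_le_card hsubS
  rw [(hm _).1] at this
  omega

/-! Placements -/

theorem place31 (P : Set Cell) : IsPlacement P31 P ↔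
    ∃ x y : ℤ, P = {(x - 1, y), (x, y), (x + 1, y)} ∨ P = {(x, y - 1), (x, y), (x, y + 1)} := by
  constructor
  · rintro ⟨f, ⟨e₁, e₂, s, ⟨t1, t2⟩, h1, h2, hf⟩, rfl⟩
    refine ⟨(f (0, 1)).1, (f (0, 1)).2, ?_⟩
    simp only [P31, Finset.coe_insert, Finset.coe_singleton, Set.image_insert_eq,
      Set.image_singleton, hf]
    rcases h1 with rfl | rfl <;> rcases h2 with rfl | rfl <;> cases s
    all_goals first
      | (left; ext ⟨u, v⟩; simp <;> omega)
      | (right; ext ⟨u, v⟩; simp <;> omega)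
  · rintro ⟨x, y, rfl | rfl⟩
    · refine ⟨_, ⟨1, 1, true, (x - 1, y), Or.inl rfl, Or.inl rfl, fun p => rfl⟩, ?_⟩
      ext ⟨u, v⟩; simp [P31]; omega
    · refine ⟨_, ⟨1, 1, false, (x, y - 1), Or.inl rfl, Or.inl rfl, fun p => rfl⟩, ?_⟩
      ext ⟨u, v⟩; simp [P31]; omega

theorem place32 (P : Set Cell) : IsPlacement P32 P ↔
    ∃ x y d e : ℤ, (d = 1 ∨ d = -1) ∧ (e = 1 ∨ e = -1) ∧
      P = {(x + d, y), (x, y), (x, y + e)} := by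
  constructor
  · rintro ⟨f, ⟨e₁, e₂, s, ⟨t1, t2⟩, h1, h2, hf⟩, rfl⟩
    simp only [P32, Finset.coe_insert, Finset.coe_singleton, Set.image_insert_eq,
      Set.image_singleton, hf]
    cases s
    · refine ⟨t1, e₂ + t2, e₁, -e₂, h1, by omega, ?_⟩
      ext ⟨u, v⟩; simp <;> omega
    · refine ⟨e₁ + t1, t2, -e₁, e₂, by omega, h2, ?_⟩
      ext ⟨u, v⟩; simp <;> omega
  · rintro ⟨x, y, d, e, h1, h2, rfl⟩
    refine ⟨_, ⟨d, -e, false, (x, y + e), h1, by omega, fun p => rfl⟩, ?_⟩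
    ext ⟨u, v⟩; simp [P32]; omega

/-! Losers -/

def N4 (p : Cell) : Finset Cell :=
  {(p.1 + 1, p.2), (p.1 - 1, p.2), (p.1, p.2 + 1), (p.1, p.2 - 1)}

def N2 (p : Cell) : Finset Cell := {(p.1 + 1, p.2), (p.1 - 1, p.2)}

def flip (x : ℤ) : ℤ := if x % 2 = 0 then x + 1 else x - 1

def NP (p : Cell) : Finset Cell := {(flip p.1, p.2), (p.1, flip p.2)}

theorem flip_flip (x : ℤ) : flip (flip x) = x := by
  unfold flip; split_ifs <;> omega

theorem two_card {p q : Cell} (h : p ≠ q) : ({p, q} : Finset Cell).card = 2 :=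
  Finset.card_pair h

theorem N4_sym (x y : Cell) (h : y ∈ N4 x) : x ∈ N4 y := by
  obtain ⟨a, b⟩ := x
  obtain ⟨c, d⟩ := y
  simp [N4] at *
  omega

theorem same3 {P : Set Cell} {t : Cell → ℕ} {p q r : Cell} (hP : P = {p, q, r})
    (ht : ∀ x ∈ P, ∀ y ∈ P, y ∈ N4 x → t x = t y)
    (h1 : p ∈ N4 q) (h2 : r ∈ N4 q) (hpq : p ≠ q) (hpr : p ≠ r) (hqr : q ≠ r) :
    ∃ S : Finset Cell, 2 < S.card ∧ ↑S ⊆ P ∧ ∀ x ∈ S, ∀ y ∈ S, t x = t y := by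
  subst hP
  have e1 : t q = t p := ht q (by simp) p (by simp) h1
  have e2 : t q = t r := ht q (by simp) r (by simp) h2
  refine ⟨{p, q, r}, ?_, by simp, ?_⟩
  · rw [Finset.card_eq_three.2 ⟨p, q, r, hpq, hpr, hqr, rfl⟩]; omega
  · intro x hx y hy
    simp only [Finset.mem_insert, Finset.mem_singleton] at hx hy
    rcases hx with rfl | rfl | rfl <;> rcases hy with rfl | rfl | rfl <;> omega

theorem same2 {P : Set Cell} {t : Cell → ℕ} {N : Cell → Finset Cell} {p q : Cell}
    (hp : p ∈ P) (hq : q ∈ P)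
    (ht : ∀ x ∈ P, ∀ y ∈ P, y ∈ N x → t x = t y)
    (h1 : q ∈ N p) (hpq : p ≠ q) :
    ∃ S : Finset Cell, 1 < S.card ∧ ↑S ⊆ P ∧ ∀ x ∈ S, ∀ y ∈ S, t x = t y := by
  have e1 : t p = t q := ht p hp q hq h1
  refine ⟨{p, q}, ?_, ?_, ?_⟩
  · rw [two_card hpq]; omega
  · intro x hx
    simp at hx
    rcases hx with rfl | rfl <;> assumption
  · intro x hx y hy
    simp only [Finset.mem_insert, Finset.mem_singleton] at hx hy
    rcases hx with rfl | rfl <;> rcases hy with rfl | rfl <;> omega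

theorem l31_28 : ¬ IsWinner P31 2 8 := by
  refine loser P31 2 8 4 N4 (fun x => Finset.card_le_four) N4_sym le_rfl ?_
  intro P hP t ht
  obtain ⟨x, y, h | h⟩ := (place31 P).1 hP
  · exact same3 h ht (by simp [N4]) (by simp [N4]) (by simp) (by simp; omega) (by simp)
  · exact same3 h ht (by simp [N4]) (by simp [N4]) (by simp) (by simp; omega) (by simp)

theorem l32_28 : ¬ IsWinner P32 2 8 := by
  refine loser P32 2 8 4 N4 (fun x => Finset.card_le_four) N4_sym le_rfl ?_
  intro P hP t ht
  obtain ⟨x, y, d, e, h1, h2, h⟩ := (place32 P).1 hP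
  exact same3 h ht (by simp [N4]; omega) (by simp [N4]; omega) (by simp; omega) (by simp; omega)
    (by simp; omega)

theorem l32_12 : ¬ IsWinner P32 1 2 := by
  refine loser P32 1 2 2 N2 (fun x => Finset.card_le_two) ?_ le_rfl ?_
  · rintro ⟨a, b⟩ ⟨c, d⟩ h
    simp [N2] at *
    omega
  intro P hP t ht
  obtain ⟨x, y, d, e, h1, h2, rfl⟩ := (place32 P).1 hP
  exact same2 (p := (x, y)) (q := (x + d, y)) (by simp) (by simp) ht (by simp [N2]; omega)
    (by simp; omega)

theorem l31_12 : ¬ IsWinner P31 1 2 := by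
  refine loser P31 1 2 2 NP (fun x => Finset.card_le_two) ?_ le_rfl ?_
  · rintro ⟨a, b⟩ ⟨c, d⟩ h
    simp only [NP, Finset.mem_insert, Finset.mem_singleton, Prod.mk.injEq] at *
    rcases h with ⟨rfl, rfl⟩ | ⟨rfl, rfl⟩
    · left; exact ⟨(flip_flip _).symm, rfl⟩
    · right; exact ⟨rfl, (flip_flip _).symm⟩
  intro P hP t ht
  obtain ⟨x, y, rfl | rfl⟩ := (place31 P).1 hP
  · refine same2 (p := (x, y)) (q := (flip x, y)) (by simp) ?_ ht (by simp [NP]) ?_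
    · simp; unfold flip; split_ifs <;> omega
    · simp; unfold flip; split_ifs <;> omega
  · refine same2 (p := (x, y)) (q := (x, flip y)) (by simp) ?_ ht (by simp [NP]) ?_
    · simp; unfold flip; split_ifs <;> omega
    · simp; unfold flip; split_ifs <;> omega

/-! Winners -/

theorem win_big (A : Finset Cell) (hA : A.card = 3) (n b : ℕ) (hn : 3 ≤ n) : IsWinner A n b := by
  apply winner_of_W A n b 1
  obtain ⟨E, h1, h2, h3⟩ := exists_fresh A ∅ n (Finset.disjoint_empty_right _) (by omega)
  refine ⟨E, h2, by simp, fun F _ _ => ⟨↑A, ⟨id, ⟨1, 1, false, (0, 0), by simp⟩, by simp⟩, ?_⟩⟩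
  simpa using h1

/-- Turn 2 completion: two fresh cells extend a marked cell. -/
theorem win27 (A : Finset Cell) (u v : Fin 4 → Cell) (huv : ∀ i, u i ≠ v i)
    (c : Fin 2 → Cell) (hc : c 0 ≠ c 1)
    (hpl : ∀ (j : Fin 2) i, IsPlacement A {c j, c j + u i, c j + v i})
    (hfree : ∀ (j k : Fin 2) i, c j + u i ≠ c k ∧ c j + v i ≠ c k)
    (hdis : ∀ (q q' : Fin 2 × Fin 4), q ≠ q' →
      Disjoint ({c q.1 + u q.2, c q.1 + v q.2} : Finset Cell) {c q'.1 + u q'.2, c q'.1 + v q'.2}) :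
    IsWinner A 2 7 := by
  apply winner_of_W A 2 7 2
  refine ⟨{c 0, c 1}, Finset.card_pair hc, by simp, fun E hE hEd => ?_⟩
  have : ∃ q : Fin 2 × Fin 4,
      Disjoint ({c q.1 + u q.2, c q.1 + v q.2} : Finset Cell) E := by
    by_contra hcon
    push Not at hcon
    have hx : ∀ q : Fin 2 × Fin 4, ∃ x,
        x ∈ ({c q.1 + u q.2, c q.1 + v q.2} : Finset Cell) ∧ x ∈ E := by
      intro q
      exact Finset.not_disjoint_iff.1 (hcon q)
    choose g hg1 hg2 using hx
    have hinj : Function.Injective g := by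
      intro q q' h
      by_contra hne
      exact Finset.disjoint_left.1 (hdis q q' hne) (hg1 q) (h ▸ hg1 q')
    have := Finset.card_le_card_of_injOn (s := Finset.univ) (t := E) g (fun q _ => hg2 q)
      hinj.injOn
    simp [hE] at this
  obtain ⟨⟨j, i⟩, hq⟩ := this
  refine ⟨{c j + u i, c j + v i}, Finset.card_pair (by simpa using huv i), ?_, fun F _ _ => ?_⟩
  · simp only [Finset.empty_union, Finset.disjoint_union_right]
    refine ⟨?_, hq⟩
    have a0 := hfree j 0 i
    have a1 := hfree j 1 i
    simp only [Finset.disjoint_insert_right, Finset.disjoint_singleton_right, Finset.mem_insert,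
      Finset.mem_singleton, not_or]
    exact ⟨⟨a0.1.symm, a0.2.symm⟩, a1.1.symm, a1.2.symm⟩
  · refine ⟨_, hpl j i, ?_⟩
    have : c j = c 0 ∨ c j = c 1 := by
      fin_cases j <;> simp
    intro x hx
    simp only [Set.mem_insert_iff, Set.mem_singleton_iff] at hx
    simp only [Finset.coe_union, Set.mem_union, Finset.mem_coe, Finset.mem_insert,
      Finset.mem_singleton]
    rcases hx with rfl | rfl | rfl
    · left; right; exact this
    · right; left; rfl
    · right; right; rfl

theorem w31_27 : IsWinner P31 2 7 := by
  refine win27 P31 ![(1, 0), (-1, 0), (0, 1), (0, -1)] ![(2, 0), (-2, 0), (0, 2), (0, -2)]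
    (by decide) ![(0, 0), (100, 100)] (by decide) ?_ (by decide) (by decide)
  intro j i
  rw [place31]
  obtain ⟨x, y⟩ := (![(0, 0), (100, 100)] : Fin 2 → Cell) j
  fin_cases i
  · refine ⟨x + 1, y, Or.inl ?_⟩; ext ⟨u, v⟩; simp <;> omega
  · refine ⟨x - 1, y, Or.inl ?_⟩; ext ⟨u, v⟩; simp <;> omega
  · refine ⟨x, y + 1, Or.inr ?_⟩; ext ⟨u, v⟩; simp <;> omega
  · refine ⟨x, y - 1, Or.inr ?_⟩; ext ⟨u, v⟩; simp <;> omega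

theorem w32_27 : IsWinner P32 2 7 := by
  refine win27 P32 ![(1, 0), (-1, 0), (0, 1), (0, -1)] ![(1, -1), (-1, 1), (1, 1), (-1, -1)]
    (by decide) ![(0, 0), (100, 100)] (by decide) ?_ (by decide) (by decide)
  intro j i
  rw [place32]
  obtain ⟨x, y⟩ := (![(0, 0), (100, 100)] : Fin 2 → Cell) j
  fin_cases i
  · refine ⟨x + 1, y, -1, -1, by simp, by simp, ?_⟩; ext ⟨u, v⟩; simp <;> omega
  · refine ⟨x - 1, y, 1, 1, by simp, by simp, ?_⟩; ext ⟨u, v⟩; simp <;> omega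
  · refine ⟨x, y + 1, 1, -1, by simp, by simp, ?_⟩; ext ⟨u, v⟩; simp <;> omega
  · refine ⟨x, y - 1, -1, 1, by simp, by simp, ?_⟩; ext ⟨u, v⟩; simp <;> omega

theorem win11 (A : Finset Cell)
    (h : ∀ z : Cell, z ≠ (0, 0) → ∃ p q r : Cell, p ≠ (0, 0) ∧ p ≠ z ∧
      q ≠ (0, 0) ∧ q ≠ z ∧ q ≠ p ∧ r ≠ (0, 0) ∧ r ≠ z ∧ r ≠ p ∧ q ≠ r ∧
      IsPlacement A {(0, 0), p, q} ∧ IsPlacement A {(0, 0), p, r}) : IsWinner A 1 1 := by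
  apply winner_of_W A 1 1 3
  refine ⟨{(0, 0)}, by simp, by simp, fun E hE hEd => ?_⟩
  obtain ⟨z, rfl⟩ := Finset.card_eq_one.1 hE
  have hz : z ≠ (0, 0) := by
    rintro rfl
    simp at hEd
  obtain ⟨p, q, r, p1, p2, q1, q2, q3, r1, r2, r3, qr, hq, hr⟩ := h z hz
  refine ⟨{p}, by simp, by simp [p2]; exact p1, fun F hF hFd => ?_⟩
  obtain ⟨w, rfl⟩ := Finset.card_eq_one.1 hF
  have : ∃ s, s ≠ w ∧ s ≠ (0, 0) ∧ s ≠ z ∧ s ≠ p ∧ IsPlacement A {(0, 0), p, s} := by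
    by_cases hw : q = w
    · exact ⟨r, hw ▸ qr.symm, r1, r2, r3, hr⟩
    · exact ⟨q, hw, q1, q2, q3, hq⟩
  obtain ⟨s, s1, s2, s3, s4, hs⟩ := this
  refine ⟨{s}, by simp, by simp [s1, s3, s4]; exact s2, fun G _ _ => ⟨_, hs, ?_⟩⟩
  intro x hx
  simp only [Set.mem_insert_iff, Set.mem_singleton_iff] at hx
  simp only [Finset.coe_union, Set.mem_union, Finset.mem_coe, Finset.mem_singleton]
  tauto

theorem w31_11 : IsWinner P31 1 1 := by
  refine win11 P31 ?_
  rintro ⟨z₁, z₂⟩ hz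
  simp only [ne_eq, Prod.mk.injEq, place31] at *
  by_cases h : z₂ = 0
  · refine ⟨(0, 1), (0, -1), (0, 2), by simp, by simp; omega, by simp, by simp; omega, by simp,
      by simp, by simp; omega, by simp, by simp, ⟨0, 0, Or.inr ?_⟩, ⟨0, 1, Or.inr ?_⟩⟩
    all_goals ext ⟨u, v⟩; simp <;> omega
  · refine ⟨(1, 0), (-1, 0), (2, 0), by simp, by simp; omega, by simp, by simp; omega, by simp,
      by simp, by simp; omega, by simp, by simp, ⟨0, 0, Or.inl ?_⟩, ⟨1, 0, Or.inl ?_⟩⟩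
    all_goals ext ⟨u, v⟩; simp <;> omega

theorem w32_11 : IsWinner P32 1 1 := by
  refine win11 P32 ?_
  rintro ⟨z₁, z₂⟩ hz
  simp only [ne_eq, Prod.mk.injEq, place32] at *
  by_cases h : z₁ = 0
  · refine ⟨(1, 0), (1, 1), (1, -1), by simp, by simp; omega, by simp, by simp; omega, by simp,
      by simp, by simp; omega, by simp, by simp, ⟨1, 0, -1, 1, by simp, by simp, ?_⟩,
      ⟨1, 0, -1, -1, by simp, by simp, ?_⟩⟩
    all_goals ext ⟨u, v⟩; simp <;> omega
  by_cases h' : z₂ = 1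
  · refine ⟨(0, 1), (1, 0), (-1, 0), by simp, by simp; omega, by simp, by simp; omega, by simp,
      by simp, by simp; omega, by simp, by simp, ⟨0, 0, 1, 1, by simp, by simp, ?_⟩,
      ⟨0, 0, -1, 1, by simp, by simp, ?_⟩⟩
    all_goals ext ⟨u, v⟩; simp <;> omega
  · refine ⟨(0, 1), (1, 1), (-1, 1), by simp, by simp; omega, by simp, by simp; omega, by simp,
      by simp, by simp; omega, by simp, by simp, ⟨0, 1, 1, -1, by simp, by simp, ?_⟩,
      ⟨0, 1, -1, -1, by simp, by simp, ?_⟩⟩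
    all_goals ext ⟨u, v⟩; simp <;> omega

end Trom

/-- Each tromino has threshold sequence `(1, 7, ∞)`: each is a `(1,1)`-winner, a
`(1,2)`-loser, a `(2,7)`-winner, a `(2,8)`-loser, and an `(n,b)`-winner for every
`n ≥ 3` and every `b`. -/
theorem trominoes_threshold :
    (IsWinner P31 1 1 ∧ ¬ IsWinner P31 1 2 ∧
      IsWinner P31 2 7 ∧ ¬ IsWinner P31 2 8 ∧
      ∀ n b : ℕ, 3 ≤ n → IsWinner P31 n b) ∧
    (IsWinner P32 1 1 ∧ ¬ IsWinner P32 1 2 ∧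
      IsWinner P32 2 7 ∧ ¬ IsWinner P32 2 8 ∧
      ∀ n b : ℕ, 3 ≤ n → IsWinner P32 n b) := 
  ⟨⟨Trom.w31_11, Trom.l31_12, Trom.w31_27, Trom.l31_28,
    fun n b hn => Trom.win_big P31 rfl n b hn⟩,
   ⟨Trom.w32_11, Trom.l32_12, Trom.w32_27, Trom.l32_28,
    fun n b hn => Trom.win_big P32 rfl n b hn⟩⟩
end

section
/- Each of the tetrominoes P₄,₁ = {(0,0),(0,1),(0,2),(0,3)}, P₄,₂ = {(0,0),(1,0),(0,1),(0,2)}, P₄,₃ = {(0,0),(0,1),(1,1),(0,2)} and P₄,₅ = {(0,0),(0,1),(1,1),(1,2)} is a (3,11)-winner and a (3,12)-loser. -/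
/-- The I-tetromino `P₄,₁`. -/
def P41 : Finset Cell := {(0, 0), (0, 1), (0, 2), (0, 3)}

/-- The L-tetromino `P₄,₂`. -/
def P42 : Finset Cell := {(0, 0), (1, 0), (0, 1), (0, 2)}

/-- The T-tetromino `P₄,₃`. -/
def P43 : Finset Cell := {(0, 0), (0, 1), (1, 1), (0, 2)}

/-- The S-tetromino `P₄,₅`. -/
def P45 : Finset Cell := {(0, 0), (0, 1), (1, 1), (1, 2)}

/-! ### Maker's strategy -/

def kE1 (i : Fin 12) : ℤ := if i.val % 4 = 0 ∨ i.val % 4 = 3 then 1 else -1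
def kE2 (i : Fin 12) : ℤ := if i.val % 4 = 0 ∨ i.val % 4 = 1 then 1 else -1
def kS (i : Fin 12) : Bool := i.val % 2 == 1
def kLin (i : Fin 12) (p : Cell) : Cell :=
  if kS i then (kE1 i * p.2, kE2 i * p.1) else (kE1 i * p.1, kE2 i * p.2)
def kCen (i : Fin 12) : Cell := (10 * ((i.val / 4 : ℕ) : ℤ), 0)
def kT (i : Fin 12) (b : Cell) : Cell :=
  ((kCen i).1 - (kLin i b).1, (kCen i).2 - (kLin i b).2)
def kF (b : Cell) (i : Fin 12) (p : Cell) : Cell :=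
  if kS i then (kE1 i * p.2 + (kT i b).1, kE2 i * p.1 + (kT i b).2)
  else (kE1 i * p.1 + (kT i b).1, kE2 i * p.2 + (kT i b).2)

theorem kF_symm (b : Cell) (i : Fin 12) : IsSquareSymmetry (kF b i) := by
  refine ⟨kE1 i, kE2 i, kS i, kT i b, ?_, ?_, fun p => rfl⟩
  · unfold kE1; split_ifs <;> simp
  · unfold kE2; split_ifs <;> simp

def startSet : Finset Cell := {(0, 0), (10, 0), (20, 0)}

def kSet (A : Finset Cell) (b : Cell) (i : Fin 12) : Finset Cell :=
  (A.image (kF b i)).erase (kCen i)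

def wt (l : List (Finset Cell)) : ℤ :=
  (l.map (fun B => 1 + ∑ p ∈ B, |p.1|)).sum

def farSet (l : List (Finset Cell)) : Finset Cell :=
  {(100 + wt l, 0), (100 + wt l, 1), (100 + wt l, 2)}

open Classical in
noncomputable def strat (S : Fin 12 → Finset Cell) : List (Finset Cell) → Finset Cell
  | [] => startSet
  | [B] => if h : ∃ i, Disjoint (S i) B then S h.choose else ∅
  | l@(_ :: _ :: _) => farSet l

theorem wt_append (l : List (Finset Cell)) (B : Finset Cell) :
    wt (l ++ [B]) = wt l + (1 + ∑ p ∈ B, |p.1|) := by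
  simp [wt]

theorem strat_far (S : Fin 12 → Finset Cell) (l : List (Finset Cell)) (h : 2 ≤ l.length) :
    strat S l = farSet l := by
  match l, h with
  | _ :: _ :: _, _ => rfl

theorem exists_free (S : Fin 12 → Finset Cell) (hd : ∀ i j, i ≠ j → Disjoint (S i) (S j))
    (B : Finset Cell) (hB : B.card = 11) : ∃ i, Disjoint (S i) B := by
  by_contra! h
  simp only [Finset.not_disjoint_iff] at h
  choose f hf1 hf2 using h
  have hinj : Function.Injective f := by
    intro i j hij
    by_contra hne
    exact Finset.disjoint_left.1 (hd i j hne) (hf1 i) (hij ▸ hf1 j)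
  have := Finset.card_le_card_of_injOn (s := Finset.univ) (t := B) f
    (fun i _ => hf2 i) hinj.injOn
  simp [hB] at this

theorem winner_of (A : Finset Cell) (S : Fin 12 → Finset Cell)
    (hd : ∀ i j, i ≠ j → Disjoint (S i) (S j))
    (hc : ∀ i, (S i).card = 3)
    (hs : ∀ i, Disjoint (S i) startSet)
    (hb : ∀ i, ∀ p ∈ S i, p.1 < 100)
    (hp : ∀ i, ∃ f, IsSquareSymmetry f ∧ A.image f ⊆ startSet ∪ S i) :
    IsWinner A 3 11 := by
  refine ⟨strat S, fun β hβ => ?_⟩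
  obtain ⟨i, hi, hm⟩ : ∃ i, Disjoint (S i) (β 0) ∧ makerMove (strat S) β 1 = S i := by
    have h := exists_free S hd (β 0) (hβ 0).1
    refine ⟨h.choose, h.choose_spec, ?_⟩
    simp only [makerMove, List.range_one, List.map_cons, List.map_nil, strat]
    rw [dif_pos h]
  have h0 : makerMove (strat S) β 0 = startSet := by simp [makerMove, strat]
  have hfar : ∀ n, makerMove (strat S) β (n + 2) = farSet ((List.range (n + 2)).map β) := by
    intro n
    exact strat_far _ _ (by simp)
  have hwt : ∀ n, wt ((List.range (n + 1)).map β)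
      = wt ((List.range n).map β) + (1 + ∑ p ∈ β n, |p.1|) := by
    intro n
    rw [List.range_succ, List.map_append]
    exact wt_append _ _
  have hnn : ∀ n, 0 ≤ ∑ p ∈ β n, |p.1| := fun n => Finset.sum_nonneg fun _ _ => abs_nonneg _
  have hw0 : wt ((List.range 0).map β) = 0 := by simp [wt]
  have hwpos : ∀ n, 0 ≤ wt ((List.range n).map β) := by
    intro n
    induction n with
    | zero => rw [hw0]
    | succ n ih => rw [hwt]; have := hnn n; omega
  have hbr : ∀ n, ∀ p ∈ breakerMarks β n, p.1 < 100 + wt ((List.range n).map β) := by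
    intro n
    induction n with
    | zero => simp [breakerMarks]
    | succ n ih =>
      intro p hp
      rw [hwt]
      have h1 := hnn n
      have h2 := hwpos n
      rcases Finset.mem_union.1 hp with h | h
      · have := ih p h; omega
      · have h3 : |p.1| ≤ ∑ p ∈ β n, |p.1| :=
          Finset.single_le_sum (f := fun p : Cell => |p.1|) (fun _ _ => abs_nonneg _) h
        have := le_abs_self p.1
        omega
  have hmk : ∀ n, ∀ p ∈ makerMarks (strat S) β (n + 2),
      p.1 < 100 + wt ((List.range (n + 2)).map β) := by
    intro n
    induction n with
    | zero =>
      intro p hp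
      have h2 := hwpos 2
      simp only [makerMarks, Nat.zero_add, h0, hm, Finset.empty_union, Finset.mem_union] at hp
      simp only [Nat.zero_add]
      rcases hp with h | h
      · simp only [startSet, Finset.mem_insert, Finset.mem_singleton] at h
        rcases h with rfl | rfl | rfl <;> simp <;> omega
      · have := hb i p h
        omega
    | succ n ih =>
      intro p hp
      rw [hwt (n + 2)]
      have h1 := hnn (n + 2)
      rcases Finset.mem_union.1 hp with h | h
      · have := ih p h; omega
      · rw [hfar n] at h
        simp only [farSet, Finset.mem_insert, Finset.mem_singleton] at h
        rcases h with rfl | rfl | rfl <;> simp only <;> omega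
  refine ⟨?_, 2, ?_⟩
  · intro n
    match n with
    | 0 =>
      rw [h0]
      refine ⟨by decide, ?_⟩
      simp [makerMarks, breakerMarks]
    | 1 =>
      rw [hm]
      refine ⟨hc i, ?_⟩
      simp only [makerMarks, breakerMarks, h0, Finset.empty_union]
      exact Finset.disjoint_union_right.2 ⟨hs i, hi⟩
    | n + 2 =>
      rw [hfar n]
      constructor
      · rw [farSet, Finset.card_insert_of_notMem, Finset.card_insert_of_notMem,
          Finset.card_singleton] <;> simp
      · rw [Finset.disjoint_left]
        intro p hp hq
        have h1 : p.1 = 100 + wt ((List.range (n + 2)).map β) := by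
          simp only [farSet, Finset.mem_insert, Finset.mem_singleton] at hp
          rcases hp with rfl | rfl | rfl <;> rfl
        rcases Finset.mem_union.1 hq with h | h
        · have := hmk n p h; omega
        · have := hbr (n + 2) p h; omega
  · obtain ⟨f, hf, hsub⟩ := hp i
    refine ⟨f '' (↑A : Set Cell), ⟨f, hf, rfl⟩, ?_⟩
    have : makerMarks (strat S) β 2 = startSet ∪ S i := by
      simp [makerMarks, h0, hm]
    rw [this, ← Finset.coe_image]
    exact Finset.coe_subset.2 hsub

theorem winner_of' (A : Finset Cell) (b : Cell)
    (hd : ∀ i j, i ≠ j → Disjoint (kSet A b i) (kSet A b j))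
    (hc : ∀ i, (kSet A b i).card = 3)
    (hs : ∀ i, Disjoint (kSet A b i) startSet)
    (hb : ∀ i, ∀ p ∈ kSet A b i, p.1 < 100) :
    IsWinner A 3 11 := by
  refine winner_of A (kSet A b) hd hc hs hb fun i => ⟨kF b i, kF_symm b i, ?_⟩
  intro p hp
  by_cases h : p = kCen i
  · subst h
    refine Finset.mem_union_left _ ?_
    clear * -
    revert i
    decide
  · exact Finset.mem_union_right _ (Finset.mem_erase.2 ⟨h, hp⟩)

/-! ### Breaker's strategy -/

def nbrs (N : Finset Cell) : Finset Cell :=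
  N.biUnion fun p => {(p.1 + 1, p.2), (p.1 - 1, p.2), (p.1, p.2 + 1), (p.1, p.2 - 1)}

theorem card_nbrs (N : Finset Cell) (h : N.card = 3) : (nbrs N).card ≤ 12 := by
  have := Finset.card_biUnion_le_card_mul N
    (fun p : Cell => ({(p.1 + 1, p.2), (p.1 - 1, p.2), (p.1, p.2 + 1), (p.1, p.2 - 1)} :
      Finset Cell)) 4 (fun p _ => Finset.card_le_four)
  rw [h] at this
  exact this

theorem mem_nbrs {N : Finset Cell} {p q : Cell} (hp : p ∈ N) (h : Adjacent p q) :
    q ∈ nbrs N := by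
  refine Finset.mem_biUnion.2 ⟨p, hp, ?_⟩
  obtain ⟨a, b⟩ := p
  obtain ⟨c, d⟩ := q
  simp only [Adjacent] at h
  simp only [Finset.mem_insert, Finset.mem_singleton, Prod.mk.injEq]
  omega

theorem exists_resp (X N : Finset Cell) : ∃ R : Finset Cell, R.card = 12 ∧ Disjoint R X ∧
    (N.card = 3 → nbrs N ⊆ X ∪ R) := by
  obtain ⟨D, hD, hDX, hN⟩ : ∃ D : Finset Cell, D.card ≤ 12 ∧ Disjoint D X ∧
      (N.card = 3 → nbrs N ⊆ X ∪ D) := by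
    by_cases h : N.card = 3
    · refine ⟨nbrs N \ X, (Finset.card_le_card Finset.sdiff_subset).trans (card_nbrs N h),
        Finset.sdiff_disjoint, fun _ p hp => ?_⟩
      by_cases hx : p ∈ X <;> simp [hx, hp]
    · exact ⟨∅, by simp, by simp, fun h' => absurd h' h⟩
  obtain ⟨E, hE, hEc⟩ := (X ∪ D).finite_toSet.infinite_compl.exists_subset_card_eq (12 - D.card)
  have hE' : ∀ p ∈ E, p ∉ X ∧ p ∉ D := by
    intro p hp
    have := hE hp
    simpa using this
  refine ⟨D ∪ E, ?_, ?_, ?_⟩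
  · rw [Finset.card_union_of_disjoint, hEc]
    · omega
    · exact Finset.disjoint_right.2 fun p hp => (hE' p hp).2
  · exact Finset.disjoint_union_left.2 ⟨hDX, Finset.disjoint_left.2 fun p hp => (hE' p hp).1⟩
  · intro h p hp
    have := hN h hp
    simp only [Finset.mem_union] at this ⊢
    tauto

theorem makerMove_congr (σ : List (Finset Cell) → Finset Cell) (β γ : ℕ → Finset Cell) (n : ℕ)
    (h : ∀ i < n, β i = γ i) : makerMove σ β n = makerMove σ γ n := by
  unfold makerMove
  congr 1
  exact List.map_congr_left fun i hi => h i (List.mem_range.1 hi)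

theorem makerMarks_congr (σ : List (Finset Cell) → Finset Cell) (β γ : ℕ → Finset Cell) (n : ℕ)
    (h : ∀ i < n, β i = γ i) : makerMarks σ β (n + 1) = makerMarks σ γ (n + 1) := by
  induction n with
  | zero => simp [makerMarks, makerMove]
  | succ n ih =>
    change makerMarks σ β (n + 1) ∪ makerMove σ β (n + 1)
      = makerMarks σ γ (n + 1) ∪ makerMove σ γ (n + 1)
    rw [ih fun i hi => h i (by omega), makerMove_congr σ β γ _ h]

theorem breakerMarks_congr (β γ : ℕ → Finset Cell) (n : ℕ)
    (h : ∀ i < n, β i = γ i) : breakerMarks β n = breakerMarks γ n := by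
  induction n with
  | zero => rfl
  | succ n ih =>
    rw [breakerMarks, breakerMarks, ih fun i hi => h i (by omega), h n (by omega)]

noncomputable def hist (g : List (Finset Cell) → Finset Cell) : ℕ → List (Finset Cell)
  | 0 => []
  | n + 1 => hist g n ++ [g (hist g n)]

theorem hist_eq (g : List (Finset Cell) → Finset Cell) (n : ℕ) :
    hist g n = (List.range n).map fun k => g (hist g k) := by
  induction n with
  | zero => rfl
  | succ n ih => rw [List.range_succ, List.map_append, ← ih]; rfl

theorem exists_beta (σ : List (Finset Cell) → Finset Cell) :
    ∃ β : ℕ → Finset Cell, ∀ n, (β n).card = 12 ∧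
      Disjoint (β n) (makerMarks σ β (n + 1) ∪ breakerMarks β n) ∧
      ((makerMove σ β n).card = 3 → nbrs (makerMove σ β n) ⊆
        (makerMarks σ β (n + 1) ∪ breakerMarks β n) ∪ β n) := by
  choose r hr using exists_resp
  let ext (l : List (Finset Cell)) : ℕ → Finset Cell := fun i => l.getD i ∅
  let g (l : List (Finset Cell)) : Finset Cell :=
    r (makerMarks σ (ext l) (l.length + 1) ∪ breakerMarks (ext l) l.length)
      (makerMove σ (ext l) l.length)
  let β : ℕ → Finset Cell := fun n => g (hist g n)
  refine ⟨β, fun n => ?_⟩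
  have hlen : (hist g n).length = n := by rw [hist_eq]; simp
  have hext : ∀ i < n, ext (hist g n) i = β i := by
    intro i hi
    simp only [ext]
    rw [hist_eq]
    simp [hi, β]
  have hβ : β n = r (makerMarks σ β (n + 1) ∪ breakerMarks β n) (makerMove σ β n) := by
    change g (hist g n) = _
    simp only [g]
    rw [hlen, makerMarks_congr σ _ β n hext, breakerMarks_congr _ β n hext,
      makerMove_congr σ _ β n hext]
  rw [hβ]
  exact hr _ _

theorem adj_symm {p q : Cell} (h : Adjacent p q) : Adjacent q p := by
  unfold Adjacent at *; omega

theorem symm_adj {f : Cell → Cell} (hf : IsSquareSymmetry f) {p q : Cell} (h : Adjacent p q) :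
    Adjacent (f p) (f q) := by
  obtain ⟨e1, e2, s, t, h1, h2, hf⟩ := hf
  rw [hf, hf]
  unfold Adjacent at *
  rcases h1 with rfl | rfl <;> rcases h2 with rfl | rfl <;> cases s <;> simp <;> omega

theorem symm_inj {f : Cell → Cell} (hf : IsSquareSymmetry f) : Function.Injective f := by
  obtain ⟨e1, e2, s, t, h1, h2, hf⟩ := hf
  rintro ⟨a, b⟩ ⟨c, d⟩ h
  rw [hf, hf] at h
  rcases h1 with rfl | rfl <;> rcases h2 with rfl | rfl <;> cases s <;>
    simp at h <;> simp <;> omega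

theorem loser_of (A : Finset Cell) (hA : A.card = 4)
    (hconn : ∀ Q : Cell → Prop, (∃ p ∈ A, Q p) →
      (∀ u ∈ A, ∀ v ∈ A, Adjacent u v → Q u → Q v) → ∀ p ∈ A, Q p) :
    ¬ IsWinner A 3 12 := by
  rintro ⟨σ, hσ⟩
  obtain ⟨β, hβ⟩ := exists_beta σ
  obtain ⟨hM, n, P, ⟨f, hf, rfl⟩, hP⟩ := hσ β fun n => ⟨(hβ n).1, (hβ n).2.1⟩
  have inv : ∀ n, ∀ p ∈ makerMarks σ β n, ∀ q, Adjacent p q →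
      q ∈ makerMarks σ β n ∪ breakerMarks β n := by
    intro n
    induction n with
    | zero => simp [makerMarks]
    | succ n ih =>
      intro p hp q hpq
      rcases Finset.mem_union.1 hp with h | h
      · have := ih p h q hpq
        simp only [makerMarks, breakerMarks, Finset.mem_union] at this ⊢
        tauto
      · have := (hβ n).2.2 (hM n).1 (mem_nbrs h hpq)
        simp only [breakerMarks, Finset.mem_union] at this ⊢
        tauto
  have key : ∀ n, (∀ p ∈ A, f p ∈ makerMarks σ β n) →
      ∃ k, ∀ p ∈ A, f p ∈ makerMove σ β k := by
    intro n
    induction n with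
    | zero =>
      intro h
      refine ⟨0, fun p hp => ?_⟩
      have := h p hp
      simp [makerMarks] at this
    | succ n ih =>
      intro h
      by_cases hex : ∃ p ∈ A, f p ∈ makerMove σ β n
      · refine ⟨n, hconn (fun p => f p ∈ makerMove σ β n) hex ?_⟩
        intro u hu v hv huv hfu
        rcases Finset.mem_union.1 (h v hv) with h' | h'
        · exact absurd (inv n _ h' _ (symm_adj hf (adj_symm huv)))
            (Finset.disjoint_left.1 (hM n).2 hfu)
        · exact h'
      · push Not at hex
        exact ih fun p hp => (Finset.mem_union.1 (h p hp)).resolve_right (hex p hp)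
  obtain ⟨k, hk⟩ := key n fun p hp => hP ⟨p, hp, rfl⟩
  have := Finset.card_le_card_of_injOn f hk (symm_inj hf).injOn
  rw [hA, (hM k).1] at this
  omega

theorem conn_of (a b c d : Cell) (A : Finset Cell) (hA : A = {a, b, c, d})
    (h1 : Adjacent a b) (h2 : Adjacent b c ∨ Adjacent a c) (h3 : Adjacent c d ∨ Adjacent b d) :
    ∀ Q : Cell → Prop, (∃ p ∈ A, Q p) →
      (∀ u ∈ A, ∀ v ∈ A, Adjacent u v → Q u → Q v) → ∀ p ∈ A, Q p := by
  intro Q hex hQ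
  subst hA
  have hh : ∀ u ∈ ({a, b, c, d} : Finset Cell), ∀ v ∈ ({a, b, c, d} : Finset Cell),
      Adjacent u v → (Q u ↔ Q v) := fun u hu v hv h =>
    ⟨hQ u hu v hv h, hQ v hv u hu (adj_symm h)⟩
  have e1 : Q a ↔ Q b := hh a (by simp) b (by simp) h1
  have e2 : Q b ↔ Q c := by
    rcases h2 with h | h
    · exact hh b (by simp) c (by simp) h
    · exact e1.symm.trans (hh a (by simp) c (by simp) h)
  have e3 : Q c ↔ Q d := by
    rcases h3 with h | h
    · exact hh c (by simp) d (by simp) h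
    · exact e2.symm.trans (hh b (by simp) d (by simp) h)
  simp only [Finset.mem_insert, Finset.mem_singleton, exists_eq_or_imp, exists_eq_left] at hex
  intro p hp
  simp only [Finset.mem_insert, Finset.mem_singleton] at hp
  rcases hp with rfl | rfl | rfl | rfl <;> tauto

instance (p q : Cell) : Decidable (Adjacent p q) := by unfold Adjacent; infer_instance

/-- Each of `P₄,₁`, `P₄,₂`, `P₄,₃`, `P₄,₅` is a `(3,11)`-winner and a `(3,12)`-loser. -/
theorem tetrominoes_three_eleven :
    (IsWinner P41 3 11 ∧ ¬ IsWinner P41 3 12) ∧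
    (IsWinner P42 3 11 ∧ ¬ IsWinner P42 3 12) ∧
    (IsWinner P43 3 11 ∧ ¬ IsWinner P43 3 12) ∧
    (IsWinner P45 3 11 ∧ ¬ IsWinner P45 3 12) := by
  exact ⟨⟨winner_of' P41 (0, 0) (by decide +kernel) (by decide +kernel)
    (by decide +kernel) (by decide +kernel),
    loser_of P41 (by decide) (conn_of (0, 0) (0, 1) (0, 2) (0, 3) _ (by decide)
    (by decide +kernel) (by decide +kernel) (by decide +kernel))⟩,
    ⟨winner_of' P42 (0, 2) (by decide +kernel) (by decide +kernel)
    (by decide +kernel) (by decide +kernel),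
    loser_of P42 (by decide) (conn_of (1, 0) (0, 0) (0, 1) (0, 2) _ (by decide)
    (by decide +kernel) (by decide +kernel) (by decide +kernel))⟩,
    ⟨winner_of' P43 (0, 0) (by decide +kernel) (by decide +kernel)
    (by decide +kernel) (by decide +kernel),
    loser_of P43 (by decide) (conn_of (0, 0) (0, 1) (1, 1) (0, 2) _ (by decide)
    (by decide +kernel) (by decide +kernel) (by decide +kernel))⟩,
    ⟨winner_of' P45 (0, 0) (by decide +kernel) (by decide +kernel)
    (by decide +kernel) (by decide +kernel),
    loser_of P45 (by decide) (conn_of (0, 0) (0, 1) (1, 1) (1, 2) _ (by decide)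
    (by decide +kernel) (by decide +kernel) (by decide +kernel))⟩⟩
end

section
/- The L-tetromino P₄,₂ = {(0,0),(1,0),(0,1),(0,2)} has threshold sequence (1,5,11,∞): it is a (1,1)-winner, a (1,2)-loser, a (2,5)-winner, a (2,6)-loser, a (3,11)-winner, a (3,12)-loser, and an (n,b)-winner for every n ≥ 4 and every b ∈ ℕ. -/
open Classical in
lemma exists_fresh (S : Finset Cell) (b : ℕ) : ∃ Y : Finset Cell, Y.card = b ∧ Disjoint Y S := by
  obtain ⟨Z, hZ, hc⟩ := Infinite.exists_superset_card_eq S (S.card + b) (by omega)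
  refine ⟨Z \ S, ?_, Finset.sdiff_disjoint⟩
  rw [Finset.card_sdiff_of_subset hZ]; omega

lemma exists_pad (Y₀ S : Finset Cell) (b : ℕ) (h : Y₀.card ≤ b) :
    ∃ Y : Finset Cell, Y.card = b ∧ Disjoint Y S ∧ Y₀ \ S ⊆ Y := by
  have h1 : (Y₀ \ S).card ≤ b := (Finset.card_le_card Finset.sdiff_subset).trans h
  obtain ⟨Z, hZ, hd⟩ := exists_fresh (S ∪ (Y₀ \ S)) (b - (Y₀ \ S).card)
  rw [Finset.disjoint_union_right] at hd
  refine ⟨Z ∪ (Y₀ \ S), ?_, ?_, Finset.subset_union_right⟩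
  · rw [Finset.card_union_of_disjoint hd.2]; omega
  · rw [Finset.disjoint_union_left]; exact ⟨hd.1, Finset.sdiff_disjoint⟩

/-- The maker, to move, wins in exactly `k` turns. -/
def WinsN (A : Finset Cell) (a b : ℕ) : ℕ → Finset Cell → Finset Cell → Prop
  | 0, M, _ => ∃ P : Set Cell, IsPlacement A P ∧ P ⊆ ↑M
  | k + 1, M, B => ∃ X : Finset Cell, X.card = a ∧ Disjoint X (M ∪ B) ∧
      ∀ Y : Finset Cell, Y.card = b → Disjoint Y ((M ∪ X) ∪ B) → WinsN A a b k (M ∪ X) (B ∪ Y)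

lemma exists_move (A : Finset Cell) (a b N n : ℕ) (M B : Finset Cell) :
    ∃ X : Finset Cell, X.card = a ∧ Disjoint X (M ∪ B) ∧
      (∀ k, N = n + k + 1 → WinsN A a b (k + 1) M B →
        ∀ Y : Finset Cell, Y.card = b → Disjoint Y ((M ∪ X) ∪ B) →
          WinsN A a b k (M ∪ X) (B ∪ Y)) := by
  by_cases h : ∃ k, N = n + k + 1 ∧ WinsN A a b (k + 1) M B
  · obtain ⟨k, hk, X, h1, h2, h3⟩ := h
    refine ⟨X, h1, h2, ?_⟩
    intro k' hk' _
    obtain rfl : k' = k := by omega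
    exact h3
  · obtain ⟨X, h1, h2⟩ := exists_fresh (M ∪ B) a
    exact ⟨X, h1, h2, fun k hk hw => absurd ⟨k, hk, hw⟩ h⟩

noncomputable def mv (A : Finset Cell) (a b N n : ℕ) (M B : Finset Cell) : Finset Cell :=
  (exists_move A a b N n M B).choose

noncomputable def wst (A : Finset Cell) (a b N : ℕ) : List (Finset Cell) → Finset Cell × Finset Cell
  | [] => (∅, ∅)
  | Y :: l => ((wst A a b N l).1 ∪ mv A a b N l.length (wst A a b N l).1 (wst A a b N l).2,
      (wst A a b N l).2 ∪ Y)

noncomputable def wsig (A : Finset Cell) (a b N : ℕ) (l : List (Finset Cell)) : Finset Cell :=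
  mv A a b N l.length (wst A a b N l.reverse).1 (wst A a b N l.reverse).2

lemma wst_eq (A : Finset Cell) (a b N : ℕ) (β : ℕ → Finset Cell) (n : ℕ) :
    wst A a b N ((List.range n).map β).reverse
      = (makerMarks (wsig A a b N) β n, breakerMarks β n) := by
  induction n with
  | zero => simp [wst, makerMarks, breakerMarks]
  | succ n ih =>
    rw [List.range_succ, List.map_append, List.reverse_append]
    simp only [List.map_cons, List.map_nil, List.reverse_cons, List.reverse_nil, List.nil_append,
      List.cons_append, wst, makerMarks, breakerMarks, makerMove, wsig, ih]
    simp

lemma wmove_eq (A : Finset Cell) (a b N : ℕ) (β : ℕ → Finset Cell) (n : ℕ) :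
    makerMove (wsig A a b N) β n =
      mv A a b N n (makerMarks (wsig A a b N) β n) (breakerMarks β n) := by
  conv_lhs => rw [makerMove, wsig, wst_eq]
  simp

lemma isWinner_of_winsN (A : Finset Cell) (a b N : ℕ) (h : WinsN A a b N ∅ ∅) :
    IsWinner A a b := by
  refine ⟨wsig A a b N, fun β hβ => ⟨fun n => ?_, N, ?_⟩⟩
  · rw [wmove_eq]
    have := (exists_move A a b N n (makerMarks (wsig A a b N) β n) (breakerMarks β n)).choose_spec
    exact ⟨this.1, this.2.1⟩
  · have key : ∀ n k, N = n + k → WinsN A a b k (makerMarks (wsig A a b N) β n)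
        (breakerMarks β n) := by
      intro n
      induction n with
      | zero => intro k hk; obtain rfl : N = k := by omega
                exact h
      | succ n ih =>
        intro k hk
        have hs := (exists_move A a b N n (makerMarks (wsig A a b N) β n)
          (breakerMarks β n)).choose_spec
        have h1 := hs.2.2 k (by omega) (ih (k + 1) (by omega)) (β n) (hβ n).1
        have h2 := (hβ n).2
        simp only [makerMarks, breakerMarks] at h2 ⊢
        rw [wmove_eq] at h2 ⊢
        exact h1 h2
    exact key N 0 rfl

/-! Losers -/

lemma exists_resp_s18 (Inv : Finset Cell → Finset Cell → Prop) (a b : ℕ)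
    (step : ∀ M B X : Finset Cell, Inv M B → Disjoint M B → X.card = a → Disjoint X (M ∪ B) →
      ∃ Y₀ : Finset Cell, Y₀.card ≤ b ∧ ∀ B' : Finset Cell, B ⊆ B' → Y₀ ⊆ M ∪ X ∪ B' →
        Disjoint (M ∪ X) B' → Inv (M ∪ X) B') (M B X : Finset Cell) :
    ∃ Y : Finset Cell, Y.card = b ∧ Disjoint Y ((M ∪ X) ∪ B) ∧
      (Inv M B → Disjoint M B → X.card = a → Disjoint X (M ∪ B) →
        Inv (M ∪ X) (B ∪ Y) ∧ Disjoint (M ∪ X) (B ∪ Y)) := by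
  by_cases h : Inv M B ∧ Disjoint M B ∧ X.card = a ∧ Disjoint X (M ∪ B)
  · obtain ⟨h1, h2, h3, h4⟩ := h
    obtain ⟨Y₀, hc, hY⟩ := step M B X h1 h2 h3 h4
    obtain ⟨Y, h5, h6, h7⟩ := exists_pad Y₀ ((M ∪ X) ∪ B) b hc
    have hd : Disjoint (M ∪ X) (B ∪ Y) := by
      rw [Finset.disjoint_left] at *
      grind
    refine ⟨Y, h5, h6, fun _ _ _ _ => ⟨hY _ Finset.subset_union_left ?_ hd, hd⟩⟩
    intro x hx
    by_cases hx' : x ∈ (M ∪ X) ∪ B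
    · grind
    · have := h7 (Finset.mem_sdiff.2 ⟨hx, hx'⟩)
      grind
  · obtain ⟨Y, h1, h2⟩ := exists_fresh ((M ∪ X) ∪ B) b
    exact ⟨Y, h1, h2, fun h3 h4 h5 h6 => absurd ⟨h3, h4, h5, h6⟩ h⟩

def lst (r : Finset Cell → Finset Cell → Finset Cell → Finset Cell)
    (σ : List (Finset Cell) → Finset Cell) : ℕ → List (Finset Cell) × Finset Cell × Finset Cell
  | 0 => ([], ∅, ∅)
  | n + 1 =>
    let s := lst r σ n
    (s.1 ++ [r s.2.1 s.2.2 (σ s.1)], s.2.1 ∪ σ s.1, s.2.2 ∪ r s.2.1 s.2.2 (σ s.1))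

lemma not_isWinner (A : Finset Cell) (Inv : Finset Cell → Finset Cell → Prop) (a b : ℕ)
    (h0 : Inv ∅ ∅)
    (step : ∀ M B X : Finset Cell, Inv M B → Disjoint M B → X.card = a → Disjoint X (M ∪ B) →
      ∃ Y₀ : Finset Cell, Y₀.card ≤ b ∧ ∀ B' : Finset Cell, B ⊆ B' → Y₀ ⊆ M ∪ X ∪ B' →
        Disjoint (M ∪ X) B' → Inv (M ∪ X) B')
    (hno : ∀ M B : Finset Cell, Inv M B → ∀ P : Set Cell, IsPlacement A P → ¬ P ⊆ ↑M) :
    ¬ IsWinner A a b := by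
  rintro ⟨σ, hσ⟩
  choose r hr1 hr2 hr3 using exists_resp_s18 Inv a b step
  let s := lst r σ
  let β : ℕ → Finset Cell := fun n => r (s n).2.1 (s n).2.2 (σ (s n).1)
  have hl : ∀ n, (List.range n).map β = (s n).1 := by
    intro n
    induction n with
    | zero => rfl
    | succ n ih => rw [List.range_succ, List.map_append, ih]; rfl
  have hm : ∀ n, makerMarks σ β n = (s n).2.1 := by
    intro n
    induction n with
    | zero => rfl
    | succ n ih => rw [makerMarks, makerMove, hl, ih]; rfl
  have hb : ∀ n, breakerMarks β n = (s n).2.2 := by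
    intro n
    induction n with
    | zero => rfl
    | succ n ih => rw [breakerMarks, ih]; rfl
  have hleg : BreakerLegal b σ β := by
    intro n
    refine ⟨hr1 _ _ _, ?_⟩
    rw [makerMarks, makerMove, hl, hm, hb]
    exact hr2 _ _ _
  obtain ⟨hM, n, P, hP, hPM⟩ := hσ β hleg
  have hinv : ∀ n, Inv (s n).2.1 (s n).2.2 ∧ Disjoint (s n).2.1 (s n).2.2 := by
    intro n
    induction n with
    | zero => exact ⟨h0, Finset.disjoint_empty_left _⟩
    | succ n ih =>
      have := hM n
      rw [makerMove, hl, hm, hb] at this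
      exact hr3 _ _ _ ih.1 ih.2 this.1 this.2
  rw [hm] at hPM
  exact hno _ _ (hinv n).1 P hP hPM

/-! Placements of P42 -/

/-- `M` contains an L-tetromino. -/
def HasL (M : Finset Cell) : Prop :=
  ∃ x y e₁ e₂ : ℤ, (e₁ = 1 ∨ e₁ = -1) ∧ (e₂ = 1 ∨ e₂ = -1) ∧
    (((x, y) ∈ M ∧ (x + e₁, y) ∈ M ∧ (x, y + e₂) ∈ M ∧ (x, y + 2 * e₂) ∈ M) ∨
     ((x, y) ∈ M ∧ (x, y + e₂) ∈ M ∧ (x + e₁, y) ∈ M ∧ (x + 2 * e₁, y) ∈ M))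

lemma hasL_iff (M : Finset Cell) :
    (∃ P : Set Cell, IsPlacement P42 P ∧ P ⊆ ↑M) ↔ HasL M := by
  constructor
  · rintro ⟨P, ⟨f, ⟨e₁, e₂, s, ⟨x, y⟩, h1, h2, hf⟩, rfl⟩, hP⟩
    refine ⟨x, y, e₁, e₂, h1, h2, ?_⟩
    have k1 : f (0, 0) ∈ M := hP ⟨_, by simp [P42], rfl⟩
    have k2 : f (1, 0) ∈ M := hP ⟨_, by simp [P42], rfl⟩
    have k3 : f (0, 1) ∈ M := hP ⟨_, by simp [P42], rfl⟩
    have k4 : f (0, 2) ∈ M := hP ⟨_, by simp [P42], rfl⟩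
    rw [hf] at k1 k2 k3 k4
    cases s
    · left
      simp at k1 k2 k3 k4
      refine ⟨k1, ?_, ?_, ?_⟩
      · rwa [add_comm]
      · rwa [add_comm y]
      · rwa [add_comm y, mul_comm]
    · right
      simp at k1 k2 k3 k4
      refine ⟨k1, ?_, ?_, ?_⟩
      · rwa [add_comm]
      · rwa [add_comm x]
      · rwa [add_comm x, mul_comm]
  · rintro ⟨x, y, e₁, e₂, h1, h2, h | h⟩
    · refine ⟨_, ⟨fun p => (e₁ * p.1 + x, e₂ * p.2 + y), ⟨e₁, e₂, false, (x, y), h1, h2, ?_⟩, rfl⟩, ?_⟩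
      · simp
      · rintro _ ⟨p, hp, rfl⟩
        simp [P42] at hp
        obtain ⟨a1, a2, a3, a4⟩ := h
        rw [add_comm] at a2
        rw [add_comm y] at a3
        rw [add_comm y, mul_comm] at a4
        rcases hp with rfl | rfl | rfl | rfl <;> simp [a1, a2, a3, a4]
    · refine ⟨_, ⟨fun p => (e₁ * p.2 + x, e₂ * p.1 + y), ⟨e₁, e₂, true, (x, y), h1, h2, ?_⟩, rfl⟩, ?_⟩
      · simp
      · rintro _ ⟨p, hp, rfl⟩
        simp [P42] at hp
        obtain ⟨a1, a2, a3, a4⟩ := h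
        rw [add_comm] at a2
        rw [add_comm x] at a3
        rw [add_comm x, mul_comm] at a4
        rcases hp with rfl | rfl | rfl | rfl <;> simp [a1, a2, a3, a4]

/-! Losers: concrete -/

lemma loser12 : ¬ IsWinner P42 1 2 := by
  refine not_isWinner P42 (fun M B => (∀ x y, (x, y) ∈ M → (x + 1, y) ∈ B ∧ (x - 1, y) ∈ B) ∧
    Disjoint M B) 1 2 (by simp) ?_ ?_
  · rintro M B X ⟨hI, -⟩ hd hc hX
    obtain ⟨⟨u, v⟩, rfl⟩ := Finset.card_eq_one.1 hc
    refine ⟨{(u + 1, v), (u - 1, v)}, Finset.card_le_two, fun B' hB hY hd' => ⟨?_, hd'⟩⟩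
    rw [Finset.disjoint_left] at hX hd hd'
    intro x y hxy
    rcases Finset.mem_union.1 hxy with h | h
    · exact ⟨hB (hI _ _ h).1, hB (hI _ _ h).2⟩
    · simp at h
      obtain ⟨rfl, rfl⟩ := h
      have h1 : (x + 1, y) ∉ M := fun h => by
        have := (hI _ _ h).2
        simp at hX
        simp_all
      have h2 : (x - 1, y) ∉ M := fun h => by
        have := (hI _ _ h).1
        simp at hX
        simp_all
      have k1 := @hY (x + 1, y) (by simp)
      have k2 := @hY (x - 1, y) (by simp)
      simp_all
  · rintro M B ⟨hI, hd⟩ P hP hPM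
    rw [Finset.disjoint_left] at hd
    obtain ⟨x, y, e₁, e₂, h1, h2, h⟩ := (hasL_iff M).1 ⟨P, hP, hPM⟩
    have : (x, y) ∈ M ∧ (x + e₁, y) ∈ M := by tauto
    have k := hI _ _ this.1
    rcases h1 with rfl | rfl
    · exact hd this.2 k.1
    · exact hd this.2 k.2

def nb4 (c : Cell) : Finset Cell :=
  {(c.1 + 1, c.2), (c.1 - 1, c.2), (c.1, c.2 + 1), (c.1, c.2 - 1)}

lemma nb4_symm (c d : Cell) : d ∈ nb4 c ↔ c ∈ nb4 d := by
  obtain ⟨a, b⟩ := c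
  obtain ⟨a', b'⟩ := d
  simp [nb4]; omega

lemma loser312 : ¬ IsWinner P42 3 12 := by
  refine not_isWinner P42 (fun M B => (∀ c ∈ M, nb4 c ⊆ M ∪ B) ∧ ¬ HasL M) 3 12 ?_ ?_ ?_
  · simp [HasL]
  · rintro M B X ⟨hI, hL⟩ hd hc hX
    refine ⟨X.biUnion nb4, ?_, fun B' hB hY hd' => ⟨?_, ?_⟩⟩
    · calc _ ≤ X.card * 4 := Finset.card_biUnion_le_card_mul _ _ _ (fun c _ => Finset.card_le_four)
        _ = 12 := by rw [hc]
    · intro c hc'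
      rcases Finset.mem_union.1 hc' with h | h
      · exact (hI c h).trans (by grind)
      · exact (Finset.subset_biUnion_of_mem nb4 h).trans hY
    · have key : ∀ c d, c ∈ M ∪ X → d ∈ M ∪ X → d ∈ nb4 c → (c ∈ M → d ∈ M) := by
        intro c d h1 h2 h3 h4
        have := hI c h4 h3
        rw [Finset.disjoint_left] at hX hd
        grind
      have key2 : ∀ c d, c ∈ M ∪ X → d ∈ M ∪ X → d ∈ nb4 c → (c ∈ M ↔ d ∈ M) :=
        fun c d h1 h2 h3 => ⟨key c d h1 h2 h3, key d c h2 h1 ((nb4_symm _ _).1 h3)⟩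
      have gen : ∀ p q r s : Cell, p ∈ M ∪ X → q ∈ M ∪ X → r ∈ M ∪ X → s ∈ M ∪ X →
          q ∈ nb4 p → r ∈ nb4 p → s ∈ nb4 r → [p, q, r, s].Nodup →
          p ∈ M ∧ q ∈ M ∧ r ∈ M ∧ s ∈ M := by
        intro p q r s hp hq hr hs h1 h2 h3 h4
        have e1 := key2 p q hp hq h1
        have e2 := key2 p r hp hr h2
        have e3 := key2 r s hr hs h3
        by_cases hpM : p ∈ M
        · tauto
        · exfalso
          have hsub : [p, q, r, s].toFinset ⊆ X := by
            intro z hz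
            simp at hz
            grind
          have := Finset.card_le_card hsub
          rw [List.toFinset_card_of_nodup h4, hc] at this
          simp at this
      rintro ⟨x, y, e₁, e₂, h1, h2, ⟨a1, a2, a3, a4⟩ | ⟨a1, a2, a3, a4⟩⟩
      · refine hL ⟨x, y, e₁, e₂, h1, h2, Or.inl (gen _ _ _ _ a1 a2 a3 a4 ?_ ?_ ?_ ?_)⟩ <;>
          simp [nb4] <;> omega
      · refine hL ⟨x, y, e₁, e₂, h1, h2, Or.inr (gen _ _ _ _ a1 a2 a3 a4 ?_ ?_ ?_ ?_)⟩ <;>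
          simp [nb4] <;> omega
  · rintro M B ⟨_, h⟩ P hP hPM
    exact h ((hasL_iff M).1 ⟨P, hP, hPM⟩)

/-- matched vertical neighbour -/
def vmate (c : Cell) : Cell := (c.1, if c.2 % 2 = 0 then c.2 + 1 else c.2 - 1)

/-- unmatched vertical neighbour -/
def om (c : Cell) : Cell := (c.1, if c.2 % 2 = 0 then c.2 - 1 else c.2 + 1)

def nb3 (c : Cell) : Finset Cell := {(c.1 + 1, c.2), (c.1 - 1, c.2), vmate c}

lemma nb3_symm (c d : Cell) : d ∈ nb3 c ↔ c ∈ nb3 d := by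
  obtain ⟨a, b⟩ := c
  obtain ⟨a', b'⟩ := d
  simp [nb3, vmate]; grind

lemma om_om (c : Cell) : om (om c) = c := by
  obtain ⟨a, b⟩ := c
  simp [om]; grind

lemma om_nb3 (c : Cell) : om c ∉ nb3 c := by
  obtain ⟨a, b⟩ := c
  simp [om, nb3, vmate]; grind

lemma self_nb3 (c : Cell) : c ∉ nb3 c := by
  obtain ⟨a, b⟩ := c
  simp [nb3, vmate]; grind

def Inv26 (M B : Finset Cell) : Prop :=
  (∀ c ∈ M, ∀ d ∈ nb3 c, d ∈ M ∨ d ∈ B) ∧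
  (∀ c ∈ M, ∀ d ∈ M, d ∈ nb3 c → om c ∈ M ∨ om c ∈ B) ∧
  (∀ e ∈ M, ∀ c ∈ M, ∀ d ∈ M, c ∈ nb3 e → d ∈ nb3 e → c = d) ∧
  (∀ c ∈ M, ∀ d ∈ M, d ∈ nb3 c → om c ∈ M → ∀ f ∈ M, f ∉ nb3 (om c))

set_option maxHeartbeats 2000000 in
lemma loser26 : ¬ IsWinner P42 2 6 := by
  refine not_isWinner P42 Inv26 2 6 ?_ ?_ ?_
  · simp [Inv26]
  · rintro M B X ⟨I1, I2, I3, I4⟩ hd hc hX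
    obtain ⟨p, q, hpq, rfl⟩ := Finset.card_eq_two.1 hc
    have hY : ∃ Y₀ : Finset Cell, Y₀.card ≤ 6 ∧ (∀ d, (d ∈ nb3 p ∨ d ∈ nb3 q) →
        d = p ∨ d = q ∨ d ∈ Y₀) ∧ (q ∈ nb3 p → om p ∈ Y₀ ∧ om q ∈ Y₀) := by
      have c3 : ∀ c, (nb3 c).card ≤ 3 := fun c => Finset.card_le_three
      by_cases h : q ∈ nb3 p
      · have h' := (nb3_symm _ _).1 h
        refine ⟨insert (om p) (insert (om q) ((nb3 p).erase q ∪ (nb3 q).erase p)), ?_, ?_, ?_⟩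
        · have e1 := Finset.card_insert_le (om p)
            (insert (om q) ((nb3 p).erase q ∪ (nb3 q).erase p))
          have e2 := Finset.card_insert_le (om q) ((nb3 p).erase q ∪ (nb3 q).erase p)
          have e3 := Finset.card_union_le ((nb3 p).erase q) ((nb3 q).erase p)
          rw [Finset.card_erase_of_mem h, Finset.card_erase_of_mem h'] at e3
          have := c3 p
          have := c3 q
          omega
        · intro d hd3
          simp only [Finset.mem_insert, Finset.mem_union, Finset.mem_erase]
          tauto
        · simp
      · refine ⟨nb3 p ∪ nb3 q, ?_, by grind, fun h' => absurd h' h⟩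
        have := Finset.card_union_le (nb3 p) (nb3 q)
        have := c3 p
        have := c3 q
        omega
    obtain ⟨Y₀, hYc, hY1, hY2⟩ := hY
    refine ⟨Y₀, hYc, fun B' hB hY hd' => ?_⟩
    have hpn : p ∉ M ∧ p ∉ B := by
      rw [Finset.disjoint_left] at hX
      have := @hX p (by simp)
      grind
    have hqn : q ∉ M ∧ q ∉ B := by
      rw [Finset.disjoint_left] at hX
      have := @hX q (by simp)
      grind
    have mem : ∀ z, z ∈ M ∪ {p, q} ↔ z ∈ M ∨ z = p ∨ z = q := by
      intro z; simp; tauto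
    have hBB : ∀ z, z ∈ B → z ∈ B' := fun z hz => hB hz
    clear hX hc
    -- edges are within old cells, or within the new pair
    have hE : ∀ c d, (c ∈ M ∨ c = p ∨ c = q) → (d ∈ M ∨ d = p ∨ d = q) → d ∈ nb3 c →
        (c ∈ M ∧ d ∈ M) ∨ (c = p ∧ d = q) ∨ (c = q ∧ d = p) := by
      intro c d h1 h2 h3
      have h3' := (nb3_symm _ _).1 h3
      have s := self_nb3 c
      have i1 := I1 c
      have i2 := I1 d
      grind
    have hBd : ∀ z, (z ∈ M ∨ z = p ∨ z = q) → z ∉ B := by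
      rw [Finset.disjoint_left] at hd
      grind
    have hY' : ∀ z ∈ Y₀, (z ∈ M ∨ z = p ∨ z = q) ∨ z ∈ B' := by
      intro z hz
      have := hY hz
      grind
    refine ⟨?_, ?_, ?_, ?_⟩
    · intro c hc d hdc
      rw [mem] at hc ⊢
      rcases hc with hc | hc
      · have := I1 c hc d hdc
        grind
      · have := hY1 d
        grind
    · intro c hc d hd2 hdc
      rw [mem] at hc hd2 ⊢
      rcases hE c d hc hd2 hdc with ⟨h1, h2⟩ | ⟨rfl, rfl⟩ | ⟨rfl, rfl⟩
      · have := I2 c h1 d h2 hdc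
        grind
      · exact hY' _ (hY2 hdc).1
      · exact hY' _ (hY2 ((nb3_symm _ _).1 hdc)).2
    · intro e he c hc d hd2 h1 h2
      rw [mem] at he hc hd2
      have a1 := hE e c he hc h1
      have a2 := hE e d he hd2 h2
      have := I3 e
      grind
    · intro c hc d hd2 hdc ho f hf hfo
      rw [mem] at hc hd2 ho hf
      have a1 := hE c d hc hd2 hdc
      have a2 := hE _ f ho hf hfo
      have n1 := om_nb3 c
      have b3 : om c ∈ M → f ∈ M → c ∈ M ∨ c ∈ B := fun u v => by
        have := I2 (om c) u f v hfo
        rwa [om_om] at this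
      rcases a1 with ⟨h1, h2⟩ | ⟨rfl, rfl⟩ | ⟨rfl, rfl⟩
      · have b1 := I2 c h1 d h2 hdc
        have b2 := I4 c h1 d h2 hdc
        grind
      · have : om c ≠ c := fun h => by
          rw [h] at a2 hfo
          have := om_om c
          simp [om, Prod.ext_iff] at h
          grind
        grind
      · have : om c ≠ c := fun h => by
          rw [h] at a2 hfo
          have := om_om c
          simp [om, Prod.ext_iff] at h
          grind
        grind
  · rintro M B ⟨I1, I2, I3, I4⟩ P hP hPM
    obtain ⟨x, y, e₁, e₂, h1, h2, ⟨a1, a2, a3, a4⟩ | ⟨a1, a2, a3, a4⟩⟩ :=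
      (hasL_iff M).1 ⟨P, hP, hPM⟩
    · have g1 : (x + e₁, y) ∈ nb3 (x, y) := by
        simp [nb3]; omega
      by_cases h : (x, y + e₂) = vmate (x, y)
      · have g2 : (x, y + e₂) ∈ nb3 (x, y) := by
          simp [nb3, h]
        have := I3 _ a1 _ a2 _ a3 g1 g2
        simp at this
        omega
      · have o1 : om (x, y + e₂) = (x, y) := by
          simp [om, vmate] at h ⊢
          split_ifs at h ⊢ <;> omega
        have g2 : (x, y + 2 * e₂) ∈ nb3 (x, y + e₂) := by
          have : vmate (x, y + e₂) = (x, y + 2 * e₂) := by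
            simp [vmate] at h ⊢
            split_ifs at h ⊢ <;> omega
          simp [nb3, this]
        exact I4 _ a3 _ a4 g2 (o1 ▸ a1) _ a2 (o1 ▸ g1)
    · have g1 : (x, y) ∈ nb3 (x + e₁, y) := by simp [nb3]; omega
      have g2 : (x + 2 * e₁, y) ∈ nb3 (x + e₁, y) := by simp [nb3]; omega
      have := I3 _ a3 _ a1 _ a4 g1 g2
      simp at this
      omega

/-! Winners -/

lemma hasL_mono {M M' : Finset Cell} (h : M ⊆ M') : HasL M → HasL M' := by
  rintro ⟨x, y, e₁, e₂, h1, h2, h3⟩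
  refine ⟨x, y, e₁, e₂, h1, h2, ?_⟩
  rcases h3 with ⟨a, b, c, d⟩ | ⟨a, b, c, d⟩
  · exact Or.inl ⟨h a, h b, h c, h d⟩
  · exact Or.inr ⟨h a, h b, h c, h d⟩

lemma exists_missed {k : ℕ} (F : Fin k → Finset Cell)
    (hF : ∀ i j, i ≠ j → Disjoint (F i) (F j)) (Y : Finset Cell) (hY : Y.card < k) :
    ∃ i, Disjoint (F i) Y := by
  by_contra hcon
  push Not at hcon
  have : ∀ i, ∃ z, z ∈ F i ∧ z ∈ Y := fun i => Finset.not_disjoint_iff.1 (hcon i)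
  choose f h1 h2 using this
  have hinj : Set.InjOn f (Finset.univ : Finset (Fin k)) := by
    intro i _ j _ hij
    by_contra hne
    exact Finset.disjoint_left.1 (hF i j hne) (h1 i) (hij ▸ h1 j)
  have := Finset.card_le_card_of_injOn f (s := Finset.univ) (t := Y) (fun i _ => h2 i) hinj
  simp at this
  omega

/-- Two-turn win via pairwise disjoint completions. -/
lemma two_turn (a b k : ℕ) (X : Finset Cell) (hX : X.card = a) (hb : b < k)
    (F : Fin k → Finset Cell) (hF : ∀ i j, i ≠ j → Disjoint (F i) (F j))
    (hc : ∀ i, (F i).card = a) (hd : ∀ i, Disjoint (F i) X) (hL : ∀ i, HasL (X ∪ F i)) :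
    IsWinner P42 a b := by
  refine isWinner_of_winsN _ _ _ 2 ⟨X, hX, by simp, fun Y hY _ => ?_⟩
  obtain ⟨i, hi⟩ := exists_missed F hF Y (by omega)
  refine ⟨F i, hc i, ?_, fun Y' _ _ => (hasL_iff _).2 (hasL_mono ?_ (hL i))⟩
  · simp only [Finset.empty_union]
    exact Finset.disjoint_union_right.2 ⟨hd i, hi⟩
  · simp

lemma winner25 : IsWinner P42 2 5 := by
  refine two_turn 2 5 6 {(0, 0), (0, 1)} (by decide) (by decide)
    ![{(1, 0), (2, 0)}, {(-1, 0), (-2, 0)}, {(1, 1), (2, 1)}, {(-1, 1), (-2, 1)},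
      {(0, 2), (1, 2)}, {(0, -1), (1, -1)}] (by decide) (by decide) (by decide) ?_
  intro i
  fin_cases i
  · exact ⟨0, 0, 1, 1, by decide⟩
  · exact ⟨0, 0, -1, 1, by decide⟩
  · exact ⟨0, 1, 1, -1, by decide⟩
  · exact ⟨0, 1, -1, -1, by decide⟩
  · exact ⟨0, 2, 1, -1, by decide⟩
  · exact ⟨0, -1, 1, 1, by decide⟩

lemma winner311 : IsWinner P42 3 11 := by
  refine two_turn 3 11 12 {(0, 0), (10, 0), (20, 0)} (by decide) (by decide)
    ![{(1, 0), (2, 0), (2, 1)}, {(-1, 0), (-2, 0), (-2, -1)},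
      {(0, 1), (0, 2), (-1, 2)}, {(0, -1), (0, -2), (1, -2)},
      {(11, 0), (12, 0), (12, 1)}, {(9, 0), (8, 0), (8, -1)},
      {(10, 1), (10, 2), (9, 2)}, {(10, -1), (10, -2), (11, -2)},
      {(21, 0), (22, 0), (22, 1)}, {(19, 0), (18, 0), (18, -1)},
      {(20, 1), (20, 2), (19, 2)}, {(20, -1), (20, -2), (21, -2)}]
    (by decide +kernel) (by decide) (by decide +kernel) ?_
  intro i
  fin_cases i
  · exact ⟨2, 0, -1, 1, by decide⟩
  · exact ⟨-2, 0, 1, -1, by decide⟩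
  · exact ⟨0, 2, -1, -1, by decide⟩
  · exact ⟨0, -2, 1, 1, by decide⟩
  · exact ⟨12, 0, -1, 1, by decide⟩
  · exact ⟨8, 0, 1, -1, by decide⟩
  · exact ⟨10, 2, -1, -1, by decide⟩
  · exact ⟨10, -2, 1, 1, by decide⟩
  · exact ⟨22, 0, -1, 1, by decide⟩
  · exact ⟨18, 0, 1, -1, by decide⟩
  · exact ⟨20, 2, -1, -1, by decide⟩
  · exact ⟨20, -2, 1, 1, by decide⟩

lemma winner_ge4 (n b : ℕ) (hn : 4 ≤ n) : IsWinner P42 n b := by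
  obtain ⟨X, h1, h2⟩ := Infinite.exists_superset_card_eq P42 n (by simpa [P42] using hn)
  refine isWinner_of_winsN _ _ _ 1 ⟨X, h2, by simp, fun Y hY _ => (hasL_iff _).2 ?_⟩
  refine hasL_mono (M := P42) (by simpa using h1) ⟨0, 0, 1, 1, by decide⟩

/-- Three cells with two distinct completions: with breaker to move, maker wins. -/
lemma fin_double (M B : Finset Cell) (Z : Finset Cell) (hZ : 2 ≤ Z.card)
    (hd : ∀ z ∈ Z, z ∉ M ∧ z ∉ B) (hL : ∀ z ∈ Z, HasL (M ∪ {z})) (Y : Finset Cell)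
    (hY : Y.card = 1) : WinsN P42 1 1 1 M (B ∪ Y) := by
  obtain ⟨z, hz, hzY⟩ : ∃ z ∈ Z, z ∉ Y := Finset.exists_mem_notMem_of_card_lt_card (by omega)
  refine ⟨{z}, by simp, ?_, fun Y' _ _ => (hasL_iff _).2 (hL z hz)⟩
  have := hd z hz
  simp [this, hzY]

/-- Domino step, from a three-in-a-row. -/
lemma row_win (M B : Finset Cell) (p : Cell) (hp : p ∉ M ∧ p ∉ B) (Z : Finset Cell)
    (hZ : Z.card = 4) (hB : (Z ∩ B).card ≤ 2) (hM : ∀ z ∈ Z, z ∉ M ∧ z ≠ p)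
    (hL : ∀ z ∈ Z, HasL (M ∪ {p} ∪ {z})) : WinsN P42 1 1 2 M B := by
  refine ⟨{p}, by simp, by simp [hp], fun Y hY _ => ?_⟩
  refine fin_double _ _ (Z \ B) ?_ ?_ ?_ Y hY
  · have := Finset.card_sdiff_add_card_inter Z B
    omega
  · intro z hz
    rw [Finset.mem_sdiff] at hz
    have := hM z hz.1
    simp [this, hz.2]
  · intro z hz
    exact hL z (Finset.mem_sdiff.1 hz).1

lemma inter_card_le {Z : Finset Cell} {y₁ y₂ : Cell} : (Z ∩ {y₁, y₂}).card ≤ 2 :=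
  (Finset.card_le_card Finset.inter_subset_right).trans Finset.card_le_two

lemma dominoV (y₁ y₂ : Cell) (h : y₁.1 ≠ 0) : WinsN P42 1 1 2 {(0, 0), (0, 1)} {y₁, y₂} := by
  have h1 : ∀ t, y₁ ≠ (0, t) := fun t ht => h (by rw [ht])
  by_cases h2 : y₂ = (0, 2)
  · subst h2
    refine row_win _ _ (0, -1) ⟨by decide, ?_⟩ {(1, -1), (-1, -1), (1, 1), (-1, 1)} (by decide)
      inter_card_le (by decide) ?_
    · simp [(h1 _).symm]
    · intro z hz
      simp at hz
      rcases hz with rfl | rfl | rfl | rfl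
      · exact ⟨0, -1, 1, 1, by decide⟩
      · exact ⟨0, -1, -1, 1, by decide⟩
      · exact ⟨0, 1, 1, -1, by decide⟩
      · exact ⟨0, 1, -1, -1, by decide⟩
  · refine row_win _ _ (0, 2) ⟨by decide, ?_⟩ {(1, 0), (-1, 0), (1, 2), (-1, 2)} (by decide)
      inter_card_le (by decide) ?_
    · simp [(h1 _).symm, Ne.symm h2]
    · intro z hz
      simp at hz
      rcases hz with rfl | rfl | rfl | rfl
      · exact ⟨0, 0, 1, 1, by decide⟩
      · exact ⟨0, 0, -1, 1, by decide⟩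
      · exact ⟨0, 2, 1, -1, by decide⟩
      · exact ⟨0, 2, -1, -1, by decide⟩

lemma dominoH (y₁ y₂ : Cell) (h : y₁.2 ≠ 0) : WinsN P42 1 1 2 {(0, 0), (1, 0)} {y₁, y₂} := by
  have h1 : ∀ t, y₁ ≠ (t, 0) := fun t ht => h (by rw [ht])
  by_cases h2 : y₂ = (2, 0)
  · subst h2
    refine row_win _ _ (-1, 0) ⟨by decide, ?_⟩ {(-1, 1), (-1, -1), (1, 1), (1, -1)} (by decide)
      inter_card_le (by decide) ?_
    · simp [(h1 _).symm]
    · intro z hz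
      simp at hz
      rcases hz with rfl | rfl | rfl | rfl
      · exact ⟨-1, 0, 1, 1, by decide⟩
      · exact ⟨-1, 0, 1, -1, by decide⟩
      · exact ⟨1, 0, -1, 1, by decide⟩
      · exact ⟨1, 0, -1, -1, by decide⟩
  · refine row_win _ _ (2, 0) ⟨by decide, ?_⟩ {(0, 1), (0, -1), (2, 1), (2, -1)} (by decide)
      inter_card_le (by decide) ?_
    · simp [(h1 _).symm, Ne.symm h2]
    · intro z hz
      simp at hz
      rcases hz with rfl | rfl | rfl | rfl
      · exact ⟨0, 0, 1, 1, by decide⟩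
      · exact ⟨0, 0, 1, -1, by decide⟩
      · exact ⟨2, 0, -1, 1, by decide⟩
      · exact ⟨2, 0, -1, -1, by decide⟩

lemma winner11 : IsWinner P42 1 1 := by
  refine isWinner_of_winsN _ _ _ 4 ⟨{(0, 0)}, by simp, by simp, fun Y hY hYd => ?_⟩
  obtain ⟨y₁, rfl⟩ := Finset.card_eq_one.1 hY
  by_cases h : y₁.1 = 0
  · have h' : y₁.2 ≠ 0 := by
      intro h'
      simp [Prod.ext_iff, h, h'] at hYd
    have hne : ((1, 0) : Cell) ≠ y₁ := by rintro rfl; simp at h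
    refine ⟨{(1, 0)}, by simp, ?_, fun Y' hY' _ => ?_⟩
    · simp [hne]
    · obtain ⟨y₂, rfl⟩ := Finset.card_eq_one.1 hY'
      exact dominoH y₁ y₂ h'
  · have hne : ((0, 1) : Cell) ≠ y₁ := by rintro rfl; simp at h
    refine ⟨{(0, 1)}, by simp, ?_, fun Y' hY' _ => ?_⟩
    · simp [hne]
    · obtain ⟨y₂, rfl⟩ := Finset.card_eq_one.1 hY'
      exact dominoV y₁ y₂ h

/-- The L-tetromino has threshold sequence `(1, 5, 11, ∞)`: it is a `(1,1)`-winner, a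
`(1,2)`-loser, a `(2,5)`-winner, a `(2,6)`-loser, a `(3,11)`-winner, a `(3,12)`-loser,
and an `(n,b)`-winner for every `n ≥ 4` and every `b`. -/
theorem P42_threshold :
    IsWinner P42 1 1 ∧ ¬ IsWinner P42 1 2 ∧
    IsWinner P42 2 5 ∧ ¬ IsWinner P42 2 6 ∧
    IsWinner P42 3 11 ∧ ¬ IsWinner P42 3 12 ∧
    ∀ n b : ℕ, 4 ≤ n → IsWinner P42 n b :=
  ⟨winner11, loser12, winner25, loser26, winner311, loser312, winner_ge4⟩
end
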